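/- The Heawood graph H belongs to F(HAM): H is hamiltonian and every hamiltonian cycle C ≤ H is a fixing subgraph of H, i.e., s(C;H) = |A(H)| / |A(C) ∩ A(H)|. Moreover no hamiltonian cycle of H is a strong fixing subgraph: for every hamiltonian cycle C of H there is an automorphism of C that is not an automorphism of H. -/

import Mathlib

/-- `σ` is an automorphism of the simple graph `G`. -/
def IsAut {V : Type*} (G : SimpleGraph V) (σ : Equiv.Perm V) : Prop :=
  ∀ u v, G.Adj (σ u) (σ v) ↔ G.Adj u v

/-- `|A(G)|`, the number of automorphisms of `G`. -/
noncomputable def autCard {V : Type*} (G : SimpleGraph V) : ℕ :=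
  Nat.card {σ : Equiv.Perm V // IsAut G σ}

/-- `|A(U) ∩ A(G)|`, the number of common automorphisms of `U` and `G`. -/
noncomputable def autCapCard {V : Type*} (U G : SimpleGraph V) : ℕ :=
  Nat.card {σ : Equiv.Perm V // IsAut U σ ∧ IsAut G σ}

/-- `s(U;G)`: the number of spanning subgraphs of `G` isomorphic to `U`. -/
noncomputable def sCard {V : Type*} (U G : SimpleGraph V) : ℕ :=
  Nat.card {U' : SimpleGraph V // U' ≤ G ∧ Nonempty (U' ≃g U)}

/-- `x(U;G)`: the number of graphs `X` on `V` with `U ≤ X` and `X` isomorphic to `G`. -/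
noncomputable def xCard {V : Type*} (U G : SimpleGraph V) : ℕ :=
  Nat.card {X : SimpleGraph V // U ≤ X ∧ Nonempty (X ≃g G)}

/-- `s₀(U;G)`: the number of spanning subgraphs of `G` that are `G`-similar to `U`,
i.e. images of `U` under an automorphism of `G`. -/
noncomputable def s0Card {V : Type*} (U G : SimpleGraph V) : ℕ :=
  Nat.card {U' : SimpleGraph V //
    U' ≤ G ∧ ∃ σ : Equiv.Perm V, IsAut G σ ∧ U.map σ.toEmbedding = U'}

/-- `U` is a fixing subgraph of `G`: it is a spanning subgraph and
`s(U;G) = |A(G)| / |A(U) ∩ A(G)|`. -/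
noncomputable def IsFixing {V : Type*} (U G : SimpleGraph V) : Prop :=
  U ≤ G ∧ sCard U G = autCard G / autCapCard U G

/-- `U` is a strong fixing subgraph of `G`: a fixing subgraph all of whose
automorphisms are automorphisms of `G`. -/
noncomputable def IsStrongFixing {V : Type*} (U G : SimpleGraph V) : Prop :=
  IsFixing U G ∧ ∀ σ : Equiv.Perm V, IsAut U σ → IsAut G σ

/-- `C` is a hamiltonian cycle of `G`: a connected 2-regular spanning subgraph. -/
def IsHamCycle {V : Type*} (G C : SimpleGraph V) : Prop :=
  C ≤ G ∧ C.Connected ∧ ∀ v, Nat.card {w // C.Adj v w} = 2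

/-- `G ∈ F(HAM)`: `G` is hamiltonian and every hamiltonian cycle of `G` is a
fixing subgraph of `G`. -/
noncomputable def InFHAM {V : Type*} (G : SimpleGraph V) : Prop :=
  (∃ C, IsHamCycle G C) ∧ ∀ C, IsHamCycle G C → IsFixing C G

/-- `G ∈ F*(HAM)`: `G` is hamiltonian and every hamiltonian cycle of `G` is a
strong fixing subgraph of `G`. -/
noncomputable def InFstarHAM {V : Type*} (G : SimpleGraph V) : Prop :=
  (∃ C, IsHamCycle G C) ∧ ∀ C, IsHamCycle G C → IsStrongFixing C G

/-- The generalized Petersen graph `G(n,k)`, with outer vertices `Sum.inl i = aᵢ`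
and inner vertices `Sum.inr i = bᵢ`, edges `aᵢaᵢ₊₁`, `aᵢbᵢ`, `bᵢbᵢ₊ₖ`. -/
def genPetersen (n k : ℕ) : SimpleGraph (ZMod n ⊕ ZMod n) :=
  SimpleGraph.fromRel fun v w =>
    match v, w with
    | Sum.inl i, Sum.inl j => j = i + 1
    | Sum.inl i, Sum.inr j => j = i
    | Sum.inr i, Sum.inr j => j = i + (k : ZMod n)
    | _, _ => False

/-- The Heawood graph on `ZMod 14`: `i ~ i+1` for all `i`, and `i ~ i+5` for even `i`
(LCF notation `[5,-5]⁷`). -/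
def heawood : SimpleGraph (ZMod 14) :=
  SimpleGraph.fromRel fun i j => j = i + 1 ∨ (Even i.val ∧ j = i + 5)

/-- The spanning cycle of the Heawood graph through `0, 1, …, 13` in order. -/
def heawoodCycle : SimpleGraph (ZMod 14) :=
  SimpleGraph.fromRel fun i j => j = i + 1

def hwL : List (List (ZMod 14)) :=
  [[0,1,2,3,4,5,6,7,8,9,10,11,12,13],
   [0,1,2,3,12,13,8,7,6,11,10,9,4,5],
   [0,1,2,7,6,5,4,3,12,11,10,9,8,13],
   [0,1,2,7,8,13,12,3,4,9,10,11,6,5],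
   [0,1,10,9,4,5,6,11,12,3,2,7,8,13],
   [0,1,10,9,8,13,12,11,6,7,2,3,4,5],
   [0,1,10,11,6,5,4,9,8,7,2,3,12,13],
   [0,1,10,11,12,13,8,9,4,3,2,7,6,5],
   [0,5,4,3,2,1,10,9,8,7,6,11,12,13],
   [0,5,4,3,12,13,8,9,10,11,6,7,2,1],
   [0,5,4,9,8,13,12,3,2,7,6,11,10,1],
   [0,5,4,9,10,1,2,3,12,11,6,7,8,13],
   [0,5,6,7,2,1,10,11,12,3,4,9,8,13],
   [0,5,6,7,8,13,12,11,10,9,4,3,2,1],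
   [0,5,6,11,10,1,2,7,8,9,4,3,12,13],
   [0,5,6,11,12,13,8,7,2,3,4,9,10,1],
   [0,13,8,7,2,1,10,9,4,3,12,11,6,5],
   [0,13,8,7,6,5,4,9,10,11,12,3,2,1],
   [0,13,8,9,4,5,6,7,2,3,12,11,10,1],
   [0,13,8,9,10,1,2,7,6,11,12,3,4,5],
   [0,13,12,3,2,1,10,11,6,7,8,9,4,5],
   [0,13,12,3,4,5,6,11,10,9,8,7,2,1],
   [0,13,12,11,6,5,4,3,2,7,8,9,10,1],
   [0,13,12,11,10,1,2,3,4,9,8,7,6,5]]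

def hwS (l : List (ZMod 14)) (i : ZMod 14) : ZMod 14 := l.getD i.val 0

/-- Missing neighbour of an even vertex, from the seven values. -/
def hwF (a b c d e f g : ZMod 14) (i : ZMod 14) : ZMod 14 :=
  [a, 0, b, 0, c, 0, d, 0, e, 0, f, 0, g, 0].getD i.val 0

instance hwDec : DecidableRel heawood.Adj := fun i j =>
  decidable_of_iff (i ≠ j ∧ ((j = i + 1 ∨ (Even i.val ∧ j = i + 5)) ∨
    (i = j + 1 ∨ (Even j.val ∧ i = j + 5)))) (by simp [heawood, SimpleGraph.fromRel_adj])

def hwN (i : ZMod 14) : List (ZMod 14) := [i + 1, i - 1, i + 5]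

theorem hwN_iff : ∀ i j : ZMod 14, Even i.val → heawood.Adj i j → j ∈ hwN i := by
  decide +kernel

theorem hwAdj_parity : ∀ i j : ZMod 14, heawood.Adj i j → (Even i.val ↔ ¬ Even j.val) := by
  decide +kernel

theorem hwDeg : ∀ i : ZMod 14, (Finset.univ.filter (heawood.Adj i)).card = 3 := by
  decide +kernel

theorem hwL_inj : ∀ l ∈ hwL, ∀ i j, hwS l i = hwS l j → i = j := by
  decide +kernel

theorem hwL_aut : ∀ l ∈ hwL, ∀ i j,
    heawood.Adj (hwS l i) (hwS l j) ↔ heawood.Adj i j := by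
  decide +kernel

theorem hwL_even : ∀ l ∈ hwL, ∀ i, Even (hwS l i).val ↔ Even i.val := by
  decide +kernel

set_option synthInstance.maxHeartbeats 2000000 in
set_option synthInstance.maxSize 10000 in
set_option maxRecDepth 100000 in
set_option maxHeartbeats 4000000 in
theorem hw_search : ∀ a ∈ hwN 0, ∀ b ∈ hwN 2, b ≠ a → ∀ c ∈ hwN 4, c ≠ a → c ≠ b →
    ∀ d ∈ hwN 6, d ≠ a → d ≠ b → d ≠ c →
    ∀ e ∈ hwN 8, e ≠ a → e ≠ b → e ≠ c → e ≠ d →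
    ∀ f ∈ hwN 10, f ≠ a → f ≠ b → f ≠ c → f ≠ d → f ≠ e →
    ∀ g ∈ hwN 12, g ≠ a → g ≠ b → g ≠ c → g ≠ d → g ≠ e → g ≠ f →
    ∃ l ∈ hwL, ∀ i : ZMod 14, Even i.val → hwF a b c d e f g (hwS l i) = hwS l (i + 5) := by
  decide +kernel

theorem hwF_eq (m : ZMod 14 → ZMod 14) : ∀ i : ZMod 14, Even i.val →
    hwF (m 0) (m 2) (m 4) (m 6) (m 8) (m 10) (m 12) i = m i := by
  intro i hi
  fin_cases i <;> first | rfl | (exfalso; revert hi; decide)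

theorem hwC_iff : ∀ i j : ZMod 14, heawoodCycle.Adj i j ↔
    heawood.Adj i j ∧ ¬ (Even i.val ∧ j = i + 5) ∧ ¬ (Even j.val ∧ i = j + 5) := by
  have : ∀ i j : ZMod 14, (i ≠ j ∧ (j = i + 1 ∨ i = j + 1)) ↔
    heawood.Adj i j ∧ ¬ (Even i.val ∧ j = i + 5) ∧ ¬ (Even j.val ∧ i = j + 5) := by
    decide +kernel
  intro i j
  rw [← this]
  simp [heawoodCycle, SimpleGraph.fromRel_adj]

/-- `σ` carries `C` to `D`. -/
def hwCarry (σ : Equiv.Perm (ZMod 14)) (C D : SimpleGraph (ZMod 14)) : Prop :=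
  ∀ u v, D.Adj (σ u) (σ v) ↔ C.Adj u v

theorem hwCarry.symm {σ C D} (h : hwCarry σ C D) : hwCarry σ⁻¹ D C := by
  intro u v
  rw [← h]; simp

theorem hwCarry.trans {σ τ C D E} (h : hwCarry σ C D) (h' : hwCarry τ D E) :
    hwCarry (τ * σ) C E := by
  intro u v
  rw [← h, ← h']; rfl

theorem hwCarry.unique {σ C D E} (h : hwCarry σ C D) (h' : hwCarry σ C E) : D = E := by
  ext u v
  have h1 := h (σ⁻¹ u) (σ⁻¹ v)
  have h2 := h' (σ⁻¹ u) (σ⁻¹ v)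
  simp at h1 h2
  rw [h1, h2]

theorem hw_missing (C : SimpleGraph (ZMod 14)) (hC : C ≤ heawood)
    (hd : ∀ v, Nat.card {w // C.Adj v w} = 2) (v : ZMod 14) :
    ∃ w, ∀ x, (heawood.Adj v x ∧ ¬ C.Adj v x) ↔ x = w := by
  classical
  have h1 := hd v
  rw [Nat.card_eq_fintype_card, Fintype.card_subtype] at h1
  have h2 := hwDeg v
  have hs : Finset.univ.filter (C.Adj v) ⊆ Finset.univ.filter (heawood.Adj v) := by
    intro x hx
    simp at hx ⊢
    exact hC hx
  have h3 := Finset.card_sdiff_of_subset hs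
  have h4 : (Finset.univ.filter (heawood.Adj v) \ Finset.univ.filter (C.Adj v)).card = 1 := by
    rw [h3, h1]; omega
  obtain ⟨w, hw⟩ := Finset.card_eq_one.1 h4
  refine ⟨w, fun x => ?_⟩
  have := Finset.ext_iff.1 hw x
  simpa using this

theorem hw_class (C : SimpleGraph (ZMod 14)) (hC : C ≤ heawood)
    (hd : ∀ v, Nat.card {w // C.Adj v w} = 2) :
    ∃ σ, IsAut heawood σ ∧ hwCarry σ heawoodCycle C := by
  choose m hm using hw_missing C hC hd
  have hadj : ∀ v, heawood.Adj v (m v) ∧ ¬ C.Adj v (m v) := fun v => (hm v _).2 rfl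
  have hinv : ∀ v, m (m v) = v := fun v =>
    ((hm (m v) v).1 ⟨(hadj v).1.symm, fun h => (hadj v).2 h.symm⟩).symm
  have hinj : ∀ u v, u ≠ v → m u ≠ m v := fun u v h h' => h (by rw [← hinv u, h', hinv])
  have hN : ∀ v : ZMod 14, Even v.val → m v ∈ hwN v := fun v hv => hwN_iff v _ hv (hadj v).1
  obtain ⟨l, hl, hs⟩ := hw_search (m 0) (hN _ (by decide)) (m 2) (hN _ (by decide))
    (hinj _ _ (by decide)) (m 4) (hN _ (by decide)) (hinj _ _ (by decide))
    (hinj _ _ (by decide)) (m 6) (hN _ (by decide)) (hinj _ _ (by decide))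
    (hinj _ _ (by decide)) (hinj _ _ (by decide)) (m 8) (hN _ (by decide))
    (hinj _ _ (by decide)) (hinj _ _ (by decide)) (hinj _ _ (by decide))
    (hinj _ _ (by decide)) (m 10) (hN _ (by decide)) (hinj _ _ (by decide))
    (hinj _ _ (by decide)) (hinj _ _ (by decide)) (hinj _ _ (by decide))
    (hinj _ _ (by decide)) (m 12) (hN _ (by decide)) (hinj _ _ (by decide))
    (hinj _ _ (by decide)) (hinj _ _ (by decide)) (hinj _ _ (by decide))
    (hinj _ _ (by decide)) (hinj _ _ (by decide))
  have hi : Function.Injective (hwS l) := fun i j h => hwL_inj l hl i j h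
  have hm5 : ∀ i : ZMod 14, Even i.val → m (hwS l i) = hwS l (i + 5) := by
    intro i hi
    rw [← hs i hi, hwF_eq m _ ((hwL_even l hl i).2 hi)]
  let σ : Equiv.Perm (ZMod 14) := Equiv.ofBijective (hwS l) (Finite.injective_iff_bijective.1 hi)
  refine ⟨σ, fun u v => hwL_aut l hl u v, fun u v => ?_⟩
  change C.Adj (hwS l u) (hwS l v) ↔ _
  rw [hwC_iff]
  have key : ∀ u v : ZMod 14, heawood.Adj u v → Even u.val →
      (C.Adj (hwS l u) (hwS l v) ↔ ¬ v = u + 5) := by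
    intro u v h he
    have h' := (hwL_aut l hl u v).2 h
    have h1 := hm (hwS l u) (hwS l v)
    rw [hm5 u he, hi.eq_iff] at h1
    rw [← h1]; tauto
  constructor
  · intro h
    have h' := (hwL_aut l hl u v).1 (hC h)
    exact ⟨h', fun ⟨h1, h2⟩ => (key u v h' h1).1 h h2,
      fun ⟨h1, h2⟩ => (key v u h'.symm h1).1 h.symm h2⟩
  · rintro ⟨h, h1, h2⟩
    by_cases he : Even u.val
    · exact (key u v h he).2 fun h' => h1 ⟨he, h'⟩
    · have he' : Even v.val := by
        by_contra h'
        exact he ((hwAdj_parity u v h).2 h')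
      exact ((key v u h.symm he').2 fun h' => h2 ⟨he', h'⟩).symm

theorem hw_fixing (C : SimpleGraph (ZMod 14)) (hC : C ≤ heawood)
    (hd : ∀ v, Nat.card {w // C.Adj v w} = 2) : IsFixing C heawood := by
  refine ⟨hC, ?_⟩
  have ex : ∀ U : {U' : SimpleGraph (ZMod 14) // U' ≤ heawood ∧ Nonempty (U' ≃g C)},
      ∃ σ, hwCarry σ heawood heawood ∧ hwCarry σ C U.1 := by
    rintro ⟨U, hU, ⟨e⟩⟩
    have hdU : ∀ v, Nat.card {w // U.Adj v w} = 2 := by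
      intro v
      rw [← hd (e v)]
      exact Nat.card_congr (e.toEquiv.subtypeEquiv fun w => (e.map_adj_iff).symm)
    obtain ⟨σ, h1, h2⟩ := hw_class C hC hd
    obtain ⟨τ, h3, h4⟩ := hw_class U hU hdU
    exact ⟨τ * σ⁻¹, (hwCarry.symm h1).trans h3, h2.symm.trans h4⟩
  choose t ht1 ht2 using ex
  let f : {U' : SimpleGraph (ZMod 14) // U' ≤ heawood ∧ Nonempty (U' ≃g C)} ×
      {σ : Equiv.Perm (ZMod 14) // IsAut C σ ∧ IsAut heawood σ} →
      {σ : Equiv.Perm (ZMod 14) // IsAut heawood σ} :=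
    fun p => ⟨t p.1 * p.2.1, hwCarry.trans p.2.2.2 (ht1 p.1)⟩
  have hf : Function.Bijective f := by
    constructor
    · rintro ⟨U, σ, hσ⟩ ⟨U', σ', hσ'⟩ h
      have h : t U * σ = t U' * σ' := congrArg Subtype.val h
      have hUU : U = U' := by
        apply Subtype.ext
        have h1 : hwCarry (t U * σ) C U.1 := hwCarry.trans hσ.1 (ht2 U)
        have h2 : hwCarry (t U' * σ') C U'.1 := hwCarry.trans hσ'.1 (ht2 U')
        rw [h] at h1
        exact h1.unique h2
      subst hUU
      have := mul_left_cancel h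
      subst this
      rfl
    · rintro ⟨σ, hσ⟩
      let D : SimpleGraph (ZMod 14) := C.comap (σ⁻¹ : Equiv.Perm (ZMod 14))
      have hD : hwCarry σ C D := by
        intro u v
        simp [D]
      have hDH : D ≤ heawood := by
        intro u v h
        have h1 := hC (show C.Adj (σ⁻¹ u) (σ⁻¹ v) from h)
        exact (hwCarry.symm hσ u v).1 h1
      let U : {U' : SimpleGraph (ZMod 14) // U' ≤ heawood ∧ Nonempty (U' ≃g C)} :=
        ⟨D, hDH, ⟨⟨σ⁻¹, by intro u v; rfl⟩⟩⟩
      refine ⟨⟨U, (t U)⁻¹ * σ, ?_, ?_⟩, ?_⟩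
      · exact hwCarry.trans hD (ht2 U).symm
      · exact hwCarry.trans hσ (ht1 U).symm
      · apply Subtype.ext
        simp [f]
  have hcard := Nat.card_eq_of_bijective f hf
  rw [Nat.card_prod] at hcard
  unfold sCard autCard autCapCard
  rw [← hcard]
  have : Nonempty {σ : Equiv.Perm (ZMod 14) // IsAut C σ ∧ IsAut heawood σ} :=
    ⟨⟨1, fun _ _ => Iff.rfl, fun _ _ => Iff.rfl⟩⟩
  exact (Nat.mul_div_cancel _ Nat.card_pos).symm

theorem hwC_ham : IsHamCycle heawood heawoodCycle := by
  refine ⟨fun u v h => ((hwC_iff u v).1 h).1, ?_, ?_⟩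
  · have h0 : ∀ n : ℕ, heawoodCycle.Reachable 0 (n : ZMod 14) := by
      intro n
      induction n with
      | zero => simp
      | succ k ih =>
        refine ih.trans (SimpleGraph.Adj.reachable ?_)
        simp [heawoodCycle, SimpleGraph.fromRel_adj]
        decide
    have h1 : ∀ v, heawoodCycle.Reachable 0 v := by
      intro v
      simpa using h0 v.val
    exact ⟨fun u v => (h1 u).symm.trans (h1 v)⟩
  · intro v
    have h : ∀ v : ZMod 14, (Finset.univ.filter fun w : ZMod 14 =>
        heawood.Adj v w ∧ ¬ (Even v.val ∧ w = v + 5) ∧ ¬ (Even w.val ∧ v = w + 5)).card = 2 := by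
      decide +kernel
    simp only [hwC_iff]
    rw [Nat.card_eq_fintype_card, Fintype.card_subtype]
    exact h v

/-- The Heawood graph belongs to `F(HAM)`, and no hamiltonian cycle of it is a
strong fixing subgraph: each hamiltonian cycle has an automorphism that is not an
automorphism of the Heawood graph. -/
theorem heawood_inFHAM :
    InFHAM heawood ∧
      ∀ C, IsHamCycle heawood C →
        ∃ σ : Equiv.Perm (ZMod 14), IsAut C σ ∧ ¬ IsAut heawood σ := by
  refine ⟨⟨⟨_, hwC_ham⟩, fun C hC => hw_fixing C hC.1 hC.2.2⟩, fun C hC => ?_⟩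
  obtain ⟨σ, h1, h2⟩ := hw_class C hC.1 hC.2.2
  let r : Equiv.Perm (ZMod 14) := Equiv.addRight 1
  have hr : hwCarry r heawoodCycle heawoodCycle := by
    intro u v
    simp [r, heawoodCycle, SimpleGraph.fromRel_adj]
  refine ⟨σ * (r * σ⁻¹), (h2.symm.trans hr).trans h2, fun h => ?_⟩
  have h3 : hwCarry (σ⁻¹ * ((σ * (r * σ⁻¹)) * σ)) heawood heawood :=
    (hwCarry.trans h1 h).trans (hwCarry.symm h1)
  have h4 : σ⁻¹ * ((σ * (r * σ⁻¹)) * σ) = r := by group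
  rw [h4] at h3
  have h5 := h3 0 5
  have h6 : ¬ (heawood.Adj ((0 : ZMod 14) + 1) (5 + 1) ↔ heawood.Adj (0 : ZMod 14) 5) := by
    decide +kernel
  exact h6 h5
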